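/- Let d ≥ 1 be an integer with d ≥ d_n and let i ≥ 0 be an integer with d+i ≤ δ−i. Then a_{d+i} ≥ a_i, and the a_i smallest monomials of B_{d+i} in the degree reverse lexicographic order are exactly the monomials of x_n^d·B_i. -/

import Mathlib

open MvPolynomial

/-- The total degree of an exponent vector. -/
def expDeg {n : ℕ} (μ : Fin n →₀ ℕ) : ℕ := μ.sum fun _ e => e

/-- Strict degree reverse lexicographic order on exponent vectors, for variables
`x_1 > ⋯ > x_n` (indexed by `Fin n` in this order). -/
def DrlLT {n : ℕ} (a b : Fin n →₀ ℕ) : Prop :=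
  expDeg a < expDeg b ∨
    (expDeg a = expDeg b ∧ ∃ i : Fin n, b i < a i ∧ ∀ j : Fin n, i < j → a j = b j)

/-- `μ` is the leading (degrevlex-largest) exponent of `p`. -/
def IsLeadExp {n : ℕ} {K : Type*} [CommSemiring K] (p : MvPolynomial (Fin n) K)
    (μ : Fin n →₀ ℕ) : Prop :=
  μ ∈ p.support ∧ ∀ ν ∈ p.support, ν ≠ μ → DrlLT ν μ

/-- The initial ideal of `I` with respect to the degree reverse lexicographic order. -/
noncomputable def initialIdeal {n : ℕ} {K : Type*} [CommRing K]
    (I : Ideal (MvPolynomial (Fin n) K)) : Ideal (MvPolynomial (Fin n) K) :=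
  Ideal.span { m | ∃ p ∈ I, p ≠ 0 ∧ ∃ μ, IsLeadExp p μ ∧ m = monomial μ (1 : K) }

/-- The standard monomials of degree `i` of `I` : exponents of the monomials of degree `i`
not lying in the initial ideal of `I`. -/
def stdMon {n : ℕ} {K : Type*} [CommRing K] (I : Ideal (MvPolynomial (Fin n) K)) (i : ℕ) :
    Set (Fin n →₀ ℕ) :=
  { μ | expDeg μ = i ∧ monomial μ (1 : K) ∉ initialIdeal I }

/-- `μ` is a minimal monomial generator of the monomial ideal `M`. -/
def IsMinGen {n : ℕ} {K : Type*} [CommRing K] (M : Ideal (MvPolynomial (Fin n) K))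
    (μ : Fin n →₀ ℕ) : Prop :=
  monomial μ (1 : K) ∈ M ∧ ∀ ν : Fin n →₀ ℕ, ν ≤ μ → ν ≠ μ → monomial ν (1 : K) ∉ M

/-- `μ` satisfies property `P` with respect to the monomial ideal `M`: if `m` is the largest
index of a variable dividing `x^μ`, then every monomial of the same degree in the variables of
index `< m` also lies in `M`. -/
def SatisfiesP {n : ℕ} {K : Type*} [CommRing K] (M : Ideal (MvPolynomial (Fin n) K))
    (μ : Fin n →₀ ℕ) : Prop :=
  ∀ m : Fin n, μ m ≠ 0 → (∀ j : Fin n, m < j → μ j = 0) →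
    ∀ ν : Fin n →₀ ℕ, expDeg ν = expDeg μ → (∀ j : Fin n, m ≤ j → ν j = 0) →
      monomial ν (1 : K) ∈ M

/-- Conjecture E (Pardue) holds for the ideal `I`: every minimal generator of the initial
ideal of `I` satisfies property `P`. -/
def ConjE {n : ℕ} {K : Type*} [CommRing K] (I : Ideal (MvPolynomial (Fin n) K)) : Prop :=
  ∀ μ, IsMinGen (initialIdeal I) μ → SatisfiesP (initialIdeal I) μ

/-- `f` is a generic sequence of forms of degrees `d i` over the base field `F`: each `f i` is
homogeneous of degree `d i` and the family of all coefficients (at all monomials of degree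
`d i`) is algebraically independent over `F`. -/
def IsGenericSeq (F : Type*) {K : Type*} [CommRing F] [CommRing K] [Algebra F K]
    {n r : ℕ} (d : Fin r → ℕ) (f : Fin r → MvPolynomial (Fin n) K) : Prop :=
  (∀ i, (f i).IsHomogeneous (d i)) ∧
    AlgebraicIndependent F
      (fun p : Σ i : Fin r, { μ : Fin n →₀ ℕ // expDeg μ = d i } => (f p.1).coeff p.2.1)

/-- The projection `K[x_1,…,x_n,z] → K[x_1,…,x_n]` sending `z` (the last variable) to `0` and
fixing the other variables. -/
noncomputable def projMap (K : Type*) [CommRing K] (n : ℕ) :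
    MvPolynomial (Fin (n + 1)) K →ₐ[K] MvPolynomial (Fin n) K :=
  aeval (fun i => Fin.lastCases 0 (fun j => X j) i)

/-- Embedding of exponent vectors of `K[x_1,…,x_n]` into those of `K[x_1,…,x_n,z]`
(`z`-exponent `0`). -/
noncomputable def embExp {n : ℕ} (μ : Fin n →₀ ℕ) : Fin (n + 1) →₀ ℕ :=
  Finsupp.embDomain ⟨Fin.castSucc, Fin.castSucc_injective n⟩ μ

/-- Multiplication by `z^c` on exponent vectors in `K[x_1,…,x_n,z]`. -/
noncomputable def zShift {n : ℕ} (c : ℕ) (μ : Fin (n + 1) →₀ ℕ) : Fin (n + 1) →₀ ℕ :=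
  μ + Finsupp.single (Fin.last n) c

/-- `f` (homogeneous of degree `e`) is semi-regular on `R/I`: in each degree `t`, the
multiplication map `(R/I)_t → (R/I)_{t+e}` is injective or surjective. -/
def SemiRegularOn {vars K : Type*} [CommRing K] (I : Ideal (MvPolynomial vars K))
    (f : MvPolynomial vars K) (e : ℕ) : Prop :=
  ∀ t : ℕ,
    (∀ p ∈ homogeneousSubmodule vars K t, f * p ∈ I → p ∈ I) ∨
    (∀ q ∈ homogeneousSubmodule vars K (t + e),
      ∃ p ∈ homogeneousSubmodule vars K t, q - f * p ∈ I)

/-- The degree-`t` graded piece of `R/I`, as a `K`-submodule of the quotient. -/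
noncomputable def quotDegPart {vars K : Type*} [CommRing K] (I : Ideal (MvPolynomial vars K))
    (t : ℕ) : Submodule K (MvPolynomial vars K ⧸ I) :=
  (homogeneousSubmodule vars K t).map (Ideal.Quotient.mkₐ K I).toLinearMap

/-- A quantum `sl₂`-type relation between a raising operator `E` and a lowering operator `F` forces
the powers of `E` to be injective modulo every invariant subspace, up to the middle degree. -/
theorem mem_of_pow_raising_mem {K M : Type*} [Field K] [AddCommGroup M] [Module K M]
    (E F : Module.End K M) (J : Submodule K M) (V : ℕ → Submodule K M) (q : K) (δ : ℕ)
    (hq0 : q ≠ 0) (hq : ∀ m, 0 < m → m ≤ δ + 1 → q ^ m ≠ 1)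
    (hEJ : ∀ u ∈ J, E u ∈ J) (hFJ : ∀ u ∈ J, F u ∈ J)
    (hE : ∀ i, ∀ u ∈ V i, E u ∈ V (i + 1)) (hF : ∀ i, ∀ u ∈ V (i + 1), F u ∈ V i)
    (hF0 : ∀ u ∈ V 0, F u = 0)
    (hrel : ∀ i, ∀ u ∈ V i,
      F (E u) = q • E (F u) + ((1 - q) * q * (q ^ δ - q ^ (2 * i))) • u)
    (i D : ℕ) (hD : D + 2 * i ≤ δ) (u : M) (hu : u ∈ V i) (h : (E ^ D) u ∈ J) : u ∈ J := by
  have hEV : ∀ m i, ∀ u ∈ V i, (E ^ m) u ∈ V (i + m) := by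
    intro m
    induction m with
    | zero => intro i u hu; simpa using hu
    | succ m ih =>
      intro i u hu
      rw [pow_succ', Module.End.mul_apply, ← add_assoc]
      exact hE _ _ (ih i u hu)
  have hEJ' : ∀ m, ∀ u ∈ J, (E ^ m) u ∈ J := by
    intro m
    induction m with
    | zero => intro u hu; simpa using hu
    | succ m ih =>
      intro u hu
      rw [pow_succ', Module.End.mul_apply]
      exact hEJ _ (ih u hu)
  have key : ∀ m i, ∀ u ∈ V i, F ((E ^ (m + 1)) u) = q ^ (m + 1) • (E ^ (m + 1)) (F u) +
      ((1 - q ^ (m + 1)) * (q ^ (δ + 1) - q ^ (2 * i + m + 1))) • (E ^ m) u := by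
    intro m
    induction m with
    | zero =>
      intro i u hu
      simp only [zero_add, pow_one, hrel i u hu, pow_zero, Module.End.one_apply]
      congr 2
      ring
    | succ m ih =>
      intro i u hu
      have e : ∀ k v, E ((E ^ k) v) = (E ^ (k + 1)) v := fun k v => by
        rw [pow_succ', Module.End.mul_apply]
      rw [← e (m + 1) u, hrel _ _ (hEV (m + 1) i u hu), ih i u hu, map_add, map_smul, map_smul,
        e, e, smul_add, smul_smul, smul_smul, add_assoc, ← add_smul]
      congr 2 <;> ring
  have prim : ∀ i D, ∀ u ∈ V i, D + 2 * i ≤ δ → F u ∈ J → (E ^ D) u ∈ J → u ∈ J := by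
    intro i D u hu hD hFu h
    induction D with
    | zero => simpa using h
    | succ m ih =>
      refine ih (by omega) ?_
      have h1 := hFJ _ h
      rw [key m i u hu] at h1
      have h2 := (J.add_mem_iff_right (J.smul_mem _ (hEJ' (m + 1) _ hFu))).1 h1
      refine (J.smul_mem_iff (mul_ne_zero ?_ ?_)).1 h2
      · exact sub_ne_zero.2 (hq _ (by omega) (by omega)).symm
      · obtain ⟨r, hr⟩ := Nat.exists_eq_add_of_lt (show 2 * i + m + 1 < δ + 1 by omega)
        rw [hr, add_assoc, pow_add, ← mul_sub_one]
        exact mul_ne_zero (pow_ne_zero _ hq0)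
          (sub_ne_zero.2 (hq _ (by omega) (by omega)))
  induction i generalizing D u with
  | zero => exact prim 0 D u hu hD (by rw [hF0 u hu]; exact J.zero_mem) h
  | succ i ih =>
    refine prim (i + 1) D u hu hD ?_ h
    have hmax : (E ^ (δ - 2 * (i + 1))) u ∈ J := by
      rw [show δ - 2 * (i + 1) = (δ - 2 * (i + 1) - D) + D by omega, pow_add,
        Module.End.mul_apply]
      exact hEJ' _ _ h
    have h1 : F ((E ^ (δ - 2 * (i + 1) + 1)) u) ∈ J := by
      rw [pow_succ', Module.End.mul_apply]
      exact hFJ _ (hEJ _ hmax)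
    rw [key _ _ u hu] at h1
    have h2 := (J.add_mem_iff_left (J.smul_mem _ hmax)).1 h1
    exact ih (δ - 2 * (i + 1) + 1) (by omega) (F u) (hF i u hu)
      ((J.smul_mem_iff (pow_ne_zero _ hq0)).1 h2)

/-- The coproduct step: a quantum `sl₂`-type relation for `E`, `F` extends to
`S + Q * E`, `Q * F + c • L`. -/
theorem raising_lowering_relation_step {K A : Type*} [Field K] [Ring A] [Algebra K A]
    {Q S L E F P : A} {q c a κ : K}
    (hQS : Q * S = q • (S * Q)) (hLQ : L * Q = q • (Q * L))
    (hLS : L * S = q • (S * L) + κ • (a • 1 - Q * Q))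
    (hSF : S * F = F * S) (hLE : L * E = E * L) (hQE : Q * E = E * Q) (hQF : Q * F = F * Q)
    (h : F * E = q • (E * F) + κ • (c • 1 - P)) :
    (Q * F + c • L) * (S + Q * E) = q • ((S + Q * E) * (Q * F + c • L)) +
      κ • ((c * a) • 1 - Q * Q * P) := by
  have e1 : Q * F * S = q • (S * (Q * F)) := by
    rw [mul_assoc, ← hSF, ← mul_assoc, hQS, smul_mul_assoc, mul_assoc]
  have e2 : L * (Q * E) = q • (Q * E * L) := by
    rw [← mul_assoc, hLQ, smul_mul_assoc, mul_assoc, hLE, mul_assoc]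
  have e3 : Q * F * (Q * E) = Q * Q * (F * E) := by
    rw [mul_assoc, ← mul_assoc F, ← hQF]; simp only [mul_assoc]
  have e4 : Q * E * (Q * F) = Q * Q * (E * F) := by
    rw [mul_assoc, ← mul_assoc E, ← hQE]; simp only [mul_assoc]
  simp only [add_mul, mul_add, smul_mul_assoc, mul_smul_comm, e1, e2, e3, e4, hLS, h, mul_sub,
    mul_one]
  module

/-- The exponent vectors that are not coordinatewise below `d`. -/
def largeExps {n : ℕ} (d : Fin n → ℕ) : Set (Fin n →₀ ℕ) := {b | ∃ j, d j ≤ b j}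

section Operators

variable {K : Type*} [Field K] {n : ℕ}

/-- The linear endomorphism sending the basis vector `b` to `c b` times the basis vector `g b`. -/
noncomputable def weightedMap {ι : Type*} (c : ι → K) (g : ι → ι) : Module.End K (ι →₀ K) :=
  Finsupp.linearCombination K fun b => Finsupp.single (g b) (c b)

theorem weightedMap_single {ι : Type*} (c : ι → K) (g : ι → ι) (b : ι) (r : K) :
    weightedMap c g (Finsupp.single b r) = Finsupp.single (g b) (r * c b) := by
  simp [weightedMap]

theorem weightedMap_mem_supported {ι : Type*} {c : ι → K} {g : ι → ι} {s t : Set ι}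
    (h : ∀ b ∈ s, c b = 0 ∨ g b ∈ t) {u : ι →₀ K} (hu : u ∈ Finsupp.supported K K s) :
    weightedMap c g u ∈ Finsupp.supported K K t := by
  rw [weightedMap, Finsupp.linearCombination_apply]
  refine Submodule.sum_mem _ fun b hb => Submodule.smul_mem _ _ ?_
  rcases h b (hu hb) with h0 | h1
  · simp [h0]
  · exact Finsupp.single_mem_supported K _ h1

/-- Raising the exponent at `j`. -/
noncomputable def upOp (K : Type*) [Field K] (j : Fin n) : Module.End K ((Fin n →₀ ℕ) →₀ K) :=
  weightedMap (fun _ => 1) (fun b => b + Finsupp.single j 1)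

/-- Scaling by `q` to the exponent at `j`. -/
noncomputable def scaleOp (q : K) (j : Fin n) : Module.End K ((Fin n →₀ ℕ) →₀ K) :=
  weightedMap (fun b => q ^ b j) id

/-- Lowering the exponent at `j`, with a factor vanishing when that exponent is `0` or `d j`. -/
noncomputable def downOp (q : K) (d : Fin n → ℕ) (j : Fin n) :
    Module.End K ((Fin n →₀ ℕ) →₀ K) :=
  weightedMap (fun b => (1 - q ^ b j) * (q ^ d j - q ^ b j)) (fun b => b - Finsupp.single j 1)

theorem upOp_single (j : Fin n) (b : Fin n →₀ ℕ) (r : K) :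
    upOp K j (Finsupp.single b r) = Finsupp.single (b + Finsupp.single j 1) r := by
  rw [upOp, weightedMap_single, mul_one]

theorem scaleOp_single (q : K) (j : Fin n) (b : Fin n →₀ ℕ) (r : K) :
    scaleOp q j (Finsupp.single b r) = Finsupp.single b (r * q ^ b j) :=
  weightedMap_single _ _ _ _

theorem downOp_single (q : K) (d : Fin n → ℕ) (j : Fin n) (b : Fin n →₀ ℕ) (r : K) :
    downOp q d j (Finsupp.single b r) = Finsupp.single (b - Finsupp.single j 1)
      (r * ((1 - q ^ b j) * (q ^ d j - q ^ b j))) :=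
  weightedMap_single _ _ _ _

theorem scaleOp_mul_upOp (q : K) (j : Fin n) :
    scaleOp q j * upOp K j = q • (upOp K j * scaleOp q j) := by
  ext b : 2
  simp [scaleOp_single, upOp_single, pow_succ, mul_comm]

theorem downOp_mul_scaleOp (q : K) (d : Fin n → ℕ) (j : Fin n) :
    downOp q d j * scaleOp q j = q • (scaleOp q j * downOp q d j) := by
  ext b : 2
  simp only [LinearMap.coe_comp, Function.comp_apply, Finsupp.lsingle_apply,
    Module.End.mul_apply, scaleOp_single, downOp_single, LinearMap.smul_apply, Finsupp.smul_single]
  congr 1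
  rcases Nat.eq_zero_or_pos (b j) with h | h
  · simp [h]
  · obtain ⟨m, hm⟩ := Nat.exists_eq_succ_of_ne_zero h.ne'
    simp [hm, pow_succ]
    ring

theorem downOp_mul_upOp (q : K) (d : Fin n → ℕ) (j : Fin n) (hd : 1 ≤ d j) :
    downOp q d j * upOp K j = q • (upOp K j * downOp q d j) +
      ((1 - q) * q) • (q ^ (d j - 1) • 1 - scaleOp q j * scaleOp q j) := by
  obtain ⟨e, he⟩ := Nat.exists_eq_add_of_le hd
  have hb (b : Fin n →₀ ℕ) : upOp K j (downOp q d j (Finsupp.single b 1)) =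
      Finsupp.single b ((1 - q ^ b j) * (q ^ d j - q ^ b j)) := by
    rw [downOp_single, upOp_single, one_mul]
    rcases Nat.eq_zero_or_pos (b j) with h | h
    · simp [h]
    · rw [tsub_add_cancel_of_le (Finsupp.single_le_iff.2 h)]
  ext b : 2
  simp only [LinearMap.coe_comp, Function.comp_apply, Finsupp.lsingle_apply, LinearMap.add_apply,
    Module.End.mul_apply, LinearMap.smul_apply, LinearMap.sub_apply, Module.End.one_apply]
  rw [hb]
  ext c
  simp only [scaleOp_single, downOp_single, upOp_single, add_tsub_cancel_right, Finsupp.add_apply,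
    Finsupp.sub_apply, Finsupp.smul_apply, Finsupp.single_apply, smul_eq_mul]
  split_ifs
  · simp [he]
    ring
  · simp

theorem commute_scaleOp_scaleOp (q : K) {i j : Fin n} :
    Commute (scaleOp q i) (scaleOp q j) := by
  ext b : 2
  simp only [LinearMap.coe_comp, Function.comp_apply, Finsupp.lsingle_apply,
    Module.End.mul_apply, scaleOp_single]
  congr 1
  ring

theorem commute_scaleOp_upOp (q : K) {i j : Fin n} (h : i ≠ j) :
    Commute (scaleOp q i) (upOp K j) := by
  ext b : 2
  simp [scaleOp_single, upOp_single, h]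

theorem commute_downOp_upOp (q : K) (d : Fin n → ℕ) {i j : Fin n} (h : i ≠ j) :
    Commute (downOp q d i) (upOp K j) := by
  ext b : 2
  have hb : b + Finsupp.single j 1 - Finsupp.single i 1 =
      b - Finsupp.single i 1 + Finsupp.single j 1 := by
    ext k
    rcases eq_or_ne k i with rfl | hk <;> simp_all [Finsupp.single_apply]
  simp only [LinearMap.coe_comp, Function.comp_apply, Finsupp.lsingle_apply,
    Module.End.mul_apply, downOp_single, upOp_single, hb]
  congr 1
  simp [h]

theorem commute_scaleOp_downOp (q : K) (d : Fin n → ℕ) {i j : Fin n} (h : i ≠ j) :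
    Commute (scaleOp q i) (downOp q d j) := by
  ext b : 2
  simp only [LinearMap.coe_comp, Function.comp_apply, Finsupp.lsingle_apply,
    Module.End.mul_apply, downOp_single, scaleOp_single]
  congr 1
  simp [h]
  ring

/-- The raising operator built from the first `k` coordinates. -/
noncomputable def raiseOp (q : K) : ℕ → Module.End K ((Fin n →₀ ℕ) →₀ K)
  | 0 => 0
  | k + 1 => if h : k < n then upOp K ⟨k, h⟩ + scaleOp q ⟨k, h⟩ * raiseOp q k else 0

/-- The lowering operator built from the first `k` coordinates. -/
noncomputable def lowerOp (q : K) (d : Fin n → ℕ) : ℕ → Module.End K ((Fin n →₀ ℕ) →₀ K)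
  | 0 => 0
  | k + 1 => if h : k < n then scaleOp q ⟨k, h⟩ * lowerOp q d k +
      q ^ (∑ l ∈ Finset.range k, if h : l < n then d ⟨l, h⟩ - 1 else 0) • downOp q d ⟨k, h⟩ else 0

theorem commute_raiseOp (q : K) (X : Module.End K ((Fin n →₀ ℕ) →₀ K)) (k : ℕ)
    (hu : ∀ j : Fin n, (j : ℕ) < k → Commute X (upOp K j))
    (hs : ∀ j : Fin n, (j : ℕ) < k → Commute X (scaleOp q j)) : Commute X (raiseOp q k) := by
  induction k with
  | zero => exact Commute.zero_right _
  | succ k ih =>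
    rw [raiseOp]
    split_ifs with h
    · exact (hu ⟨k, h⟩ (Nat.lt_succ_self k)).add_right ((hs ⟨k, h⟩ (Nat.lt_succ_self k)).mul_right
        (ih (fun j hj => hu j (by omega)) fun j hj => hs j (by omega)))
    · exact Commute.zero_right _

theorem commute_lowerOp (q : K) (d : Fin n → ℕ) (X : Module.End K ((Fin n →₀ ℕ) →₀ K)) (k : ℕ)
    (hs : ∀ j : Fin n, (j : ℕ) < k → Commute X (scaleOp q j))
    (hl : ∀ j : Fin n, (j : ℕ) < k → Commute X (downOp q d j)) :
    Commute X (lowerOp q d k) := by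
  induction k with
  | zero => exact Commute.zero_right _
  | succ k ih =>
    rw [lowerOp]
    split_ifs with h
    · exact ((hs ⟨k, h⟩ (Nat.lt_succ_self k)).mul_right
        (ih (fun j hj => hs j (by omega)) fun j hj => hl j (by omega))).add_right
        ((hl ⟨k, h⟩ (Nat.lt_succ_self k)).smul_right _)
    · exact Commute.zero_right _

theorem lowerOp_mul_raiseOp (q : K) (d : Fin n → ℕ) (hd : ∀ j, 1 ≤ d j) (k : ℕ) (hk : k ≤ n) :
    lowerOp q d k * raiseOp q k = q • (raiseOp q k * lowerOp q d k) +
      ((1 - q) * q) • (q ^ (∑ l ∈ Finset.range k, if h : l < n then d ⟨l, h⟩ - 1 else 0) • 1 -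
        weightedMap (fun b : Fin n →₀ ℕ =>
          q ^ (2 * ∑ l ∈ Finset.range k, if h : l < n then b ⟨l, h⟩ else 0)) id) := by
  induction k with
  | zero =>
    have : weightedMap (fun _ : Fin n →₀ ℕ => (1 : K)) id = 1 := by
      ext b : 2
      simp [weightedMap_single]
    simp only [Finset.range_zero, Finset.sum_empty, mul_zero, pow_zero, this, one_smul, lowerOp,
      raiseOp, sub_self (1 : Module.End K ((Fin n →₀ ℕ) →₀ K)), smul_zero, add_zero]
  | succ k ih =>
    have h : k < n := hk
    have hne : ∀ j : Fin n, (j : ℕ) < k → (⟨k, h⟩ : Fin n) ≠ j := by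
      rintro j hj rfl
      exact lt_irrefl _ hj
    have := raising_lowering_relation_step (A := Module.End K ((Fin n →₀ ℕ) →₀ K)) (scaleOp_mul_upOp q ⟨k, h⟩)
      (downOp_mul_scaleOp q d ⟨k, h⟩) (downOp_mul_upOp q d ⟨k, h⟩ (hd _))
      (commute_lowerOp q d _ k (fun j hj => (commute_scaleOp_upOp q (hne j hj).symm).symm)
        fun j hj => (commute_downOp_upOp q d (hne j hj).symm).symm).eq
      (commute_raiseOp q _ k (fun j hj => commute_downOp_upOp q d (hne j hj))
        fun j hj => (commute_scaleOp_downOp q d (hne j hj).symm).symm).eq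
      (commute_raiseOp q _ k (fun j hj => commute_scaleOp_upOp q (hne j hj))
        fun j hj => commute_scaleOp_scaleOp q).eq
      (commute_lowerOp q d _ k (fun j hj => commute_scaleOp_scaleOp q)
        fun j hj => commute_scaleOp_downOp q d (hne j hj)).eq (ih h.le)
    rw [lowerOp, raiseOp, dif_pos h, dif_pos h, this]
    congr 3
    · simp [Finset.sum_range_succ, h, pow_add]
    · ext b : 2
      simp only [LinearMap.coe_comp, Function.comp_apply, Finsupp.lsingle_apply,
        Module.End.mul_apply, weightedMap_single, scaleOp_single, id, Finset.sum_range_succ,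
        dif_pos h]
      congr 1
      ring

theorem raiseOp_mem_supported (q : K) {s t : Set (Fin n →₀ ℕ)}
    (h : ∀ b ∈ s, ∀ j, b + Finsupp.single j 1 ∈ t) (k : ℕ) {u : (Fin n →₀ ℕ) →₀ K}
    (hu : u ∈ Finsupp.supported K K s) : raiseOp q k u ∈ Finsupp.supported K K t := by
  induction k with
  | zero => exact Submodule.zero_mem _
  | succ k ih =>
    rw [raiseOp]
    split_ifs
    · exact Submodule.add_mem _ (weightedMap_mem_supported (fun b hb => Or.inr (h b hb _)) hu)
        (weightedMap_mem_supported (fun b hb => Or.inr hb) ih)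
    · exact Submodule.zero_mem _

theorem lowerOp_mem_supported (q : K) (d : Fin n → ℕ) {s t : Set (Fin n →₀ ℕ)}
    (h : ∀ b ∈ s, ∀ j, b j = 0 ∨ b j = d j ∨ b - Finsupp.single j 1 ∈ t) (k : ℕ)
    {u : (Fin n →₀ ℕ) →₀ K} (hu : u ∈ Finsupp.supported K K s) :
    lowerOp q d k u ∈ Finsupp.supported K K t := by
  induction k with
  | zero => exact Submodule.zero_mem _
  | succ k ih =>
    rw [lowerOp]
    split_ifs with hk
    · refine Submodule.add_mem _ (weightedMap_mem_supported (fun b hb => Or.inr hb) ih)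
        (Submodule.smul_mem _ _ (weightedMap_mem_supported (fun b hb => ?_) hu))
      rcases h b hb ⟨k, hk⟩ with h | h | h <;> simp [h]
    · exact Submodule.zero_mem _

/-- The Lefschetz property of the raising operator modulo the exponents not below `d`. -/
theorem mem_supported_of_raiseOp_pow (q : K) (d : Fin n → ℕ) (hd : ∀ j, 1 ≤ d j) (hq0 : q ≠ 0)
    (hq : ∀ m, 0 < m → m ≤ ∑ j, (d j - 1) + 1 → q ^ m ≠ 1) (i D : ℕ)
    (hD : D + 2 * i ≤ ∑ j, (d j - 1)) (u : (Fin n →₀ ℕ) →₀ K)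
    (hu : u ∈ Finsupp.supported K K {b : Fin n →₀ ℕ | b.degree = i})
    (h : (raiseOp q n ^ D) u ∈ Finsupp.supported K K (largeExps d)) :
    u ∈ Finsupp.supported K K (largeExps d) := by
  refine mem_of_pow_raising_mem (raiseOp q n) (lowerOp q d n) _
    (fun i => Finsupp.supported K K {b : Fin n →₀ ℕ | b.degree = i}) q _ hq0 hq
    (fun u hu => raiseOp_mem_supported q (fun b hb j => ?_) n hu)
    (fun u hu => lowerOp_mem_supported q d (fun b hb j => ?_) n hu)
    (fun i u hu => raiseOp_mem_supported q (fun b hb j => ?_) n hu)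
    (fun i u hu => lowerOp_mem_supported q d (fun b hb j => ?_) n hu)
    (fun u hu => ?_) (fun i u hu => ?_) i D hD u hu h
  · obtain ⟨l, hl⟩ := hb
    exact ⟨l, hl.trans (by simp)⟩
  · obtain ⟨l, hl⟩ := hb
    rcases eq_or_ne l j with rfl | hlj
    · rcases hl.eq_or_lt with h | h
      · exact Or.inr (Or.inl h.symm)
      · exact Or.inr (Or.inr ⟨l, by simp; omega⟩)
    · exact Or.inr (Or.inr ⟨l, by simpa [Finsupp.single_apply, hlj.symm] using hl⟩)
  · simp_all
  · rcases Nat.eq_zero_or_pos (b j) with h0 | h0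
    · exact Or.inl h0
    · refine Or.inr (Or.inr ?_)
      have hb' : b - Finsupp.single j 1 + Finsupp.single j 1 = b :=
        tsub_add_cancel_of_le (Finsupp.single_le_iff.2 h0)
      have := congrArg Finsupp.degree hb'
      simp only [map_add, Finsupp.degree_single, Set.mem_ofPred_eq] at this hb ⊢
      omega
  · have := lowerOp_mem_supported q d (t := ∅) (fun b hb j => Or.inl ?_) n hu
    · simpa using this
    · have hb' : b = 0 := (Finsupp.degree_eq_zero_iff b).1 hb
      simp [hb']
  · have hrel := LinearMap.congr_fun (lowerOp_mul_raiseOp q d hd n le_rfl) u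
    have hP : weightedMap (fun b : Fin n →₀ ℕ =>
          q ^ (2 * ∑ l ∈ Finset.range n, if h : l < n then b ⟨l, h⟩ else 0)) id u =
        q ^ (2 * i) • u := by
      rw [weightedMap, Finsupp.linearCombination_apply]
      conv_rhs => rw [← Finsupp.sum_single u, Finsupp.smul_sum]
      refine Finsupp.sum_congr fun b hb => ?_
      have hb' : b.degree = i := hu hb
      rw [Finset.sum_range]
      simp [← hb', Finsupp.degree_eq_sum, mul_comm]
    simp only [Module.End.mul_apply, LinearMap.add_apply, LinearMap.smul_apply,
      LinearMap.sub_apply, Module.End.one_apply, hP] at hrel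
    rw [hrel, Finset.sum_range, ← sub_smul, smul_smul]
    simp

end Operators

section Families

variable {n : ℕ}

/-- The exponent vectors of degree `t`. -/
def degExps (n t : ℕ) : Set (Fin n →₀ ℕ) := {μ | μ.degree = t}

noncomputable instance (t : ℕ) : Fintype (degExps n t) := (Finsupp.finite_of_degree_eq t).fintype

/-- The matrix of the degree-`t` coefficients of a family of polynomials indexed by exponents. -/
noncomputable def coeffMatrix {R : Type*} [CommRing R]
    (P : (Fin n →₀ ℕ) → MvPolynomial (Fin n) R) (t : ℕ) :
    Matrix (degExps n t) (degExps n t) R :=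
  Matrix.of fun μ ν => (P μ).coeff ν

theorem map_det_coeffMatrix {R S : Type*} [CommRing R] [CommRing S] (φ : R →+* S)
    (P : (Fin n →₀ ℕ) → MvPolynomial (Fin n) R) (t : ℕ) :
    φ (coeffMatrix P t).det = (coeffMatrix (fun μ => map φ (P μ)) t).det := by
  rw [RingHom.map_det]
  congr 1

variable {K : Type*} [Field K] {P : (Fin n →₀ ℕ) → MvPolynomial (Fin n) K}

theorem linearIndepOn_iff_det_ne_zero (hP : ∀ μ, (P μ).IsHomogeneous μ.degree) (t : ℕ) :
    LinearIndepOn K P (degExps n t) ↔ (coeffMatrix P t).det ≠ 0 := by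
  rw [← isUnit_iff_ne_zero, ← Matrix.isUnit_iff_isUnit_det,
    ← Matrix.linearIndependent_rows_iff_isUnit, LinearIndepOn, Fintype.linearIndependent_iff,
    Fintype.linearIndependent_iff]
  refine forall_congr' fun g => imp_congr_left ⟨fun h => ?_, fun h => ?_⟩
  · ext ν
    simpa [coeff_sum, coeffMatrix, Matrix.row] using congrArg (coeff (ν : Fin n →₀ ℕ)) h
  · ext ν
    by_cases hν : ν ∈ degExps n t
    · simpa [coeff_sum, coeffMatrix, Matrix.row] using congrFun h ⟨ν, hν⟩
    · rw [coeff_sum, coeff_zero]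
      refine Finset.sum_eq_zero fun μ _ => ?_
      rw [coeff_smul, (hP μ).coeff_eq_zero, smul_zero]
      rw [show Finsupp.degree (μ : Fin n →₀ ℕ) = t from μ.2]
      exact hν

theorem linearIndependent_of_linearIndepOn (hP : ∀ μ, (P μ).IsHomogeneous μ.degree)
    (h : ∀ t, LinearIndepOn K P (degExps n t)) : LinearIndependent K P := by
  rw [linearIndependent_iff']
  intro s g hg μ hμ
  refine (linearIndepOn_iff'.1 (h μ.degree)) {ν ∈ s | ν.degree = μ.degree} g (fun ν hν => ?_) ?_ μ
    (by simpa using hμ)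
  · exact (Finset.mem_filter.1 hν).2
  · have := congrArg (homogeneousComponent μ.degree) hg
    rw [map_sum, map_zero] at this
    rw [Finset.sum_filter]
    refine (Finset.sum_congr rfl fun ν _ => ?_).trans this
    rw [map_smul, homogeneousComponent_of_mem ((mem_homogeneousSubmodule _ _).2 (hP ν))]
    simp only [eq_comm (a := ν.degree)]
    split_ifs <;> simp

theorem span_range_eq_top_of_linearIndepOn (hP : ∀ μ, (P μ).IsHomogeneous μ.degree)
    (h : ∀ t, LinearIndepOn K P (degExps n t)) : Submodule.span K (Set.range P) = ⊤ := by
  have hmon : ∀ ν, monomial ν (1 : K) ∈ Submodule.span K (Set.range P) := by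
    intro ν
    set t := ν.degree with ht
    have hν : ν ∈ degExps n t := ht.symm
    have hu : IsUnit (coeffMatrix P t).det :=
      isUnit_iff_ne_zero.2 ((linearIndepOn_iff_det_ne_zero hP t).1 (h t))
    have : monomial ν (1 : K) = ∑ μ : degExps n t,
        (coeffMatrix P t)⁻¹ ⟨ν, hν⟩ μ • P μ := by
      ext κ
      rw [coeff_sum]
      by_cases hκ : κ ∈ degExps n t
      · have h1 := congrFun (congrFun (Matrix.nonsing_inv_mul _ hu) ⟨ν, hν⟩) ⟨κ, hκ⟩
        rw [Matrix.mul_apply, Matrix.one_apply] at h1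
        simp only [Subtype.mk.injEq] at h1
        rw [coeff_monomial, ← h1]
        simp [coeffMatrix]
      · rw [coeff_monomial, if_neg (by rintro rfl; exact hκ hν)]
        refine (Finset.sum_eq_zero fun μ _ => ?_).symm
        rw [coeff_smul, (hP μ).coeff_eq_zero, smul_zero]
        rw [show Finsupp.degree (μ : Fin n →₀ ℕ) = t from μ.2]
        exact hκ
    rw [this]
    exact Submodule.sum_mem _ fun μ _ => Submodule.smul_mem _ _ (Submodule.subset_span ⟨_, rfl⟩)
  rw [eq_top_iff]
  intro p _
  rw [p.as_sum]
  refine Submodule.sum_mem _ fun ν _ => ?_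
  rw [← mul_one (coeff ν p), ← smul_eq_mul, ← smul_monomial]
  exact Submodule.smul_mem _ _ (hmon ν)

/-- `p` has coefficient `1` at `μ`, and its other exponents have smaller weight. -/
def IsUnitriangularAt {R : Type*} [CommRing R] (w : (Fin n →₀ ℕ) →+ ℕ)
    (p : MvPolynomial (Fin n) R) (μ : Fin n →₀ ℕ) : Prop :=
  p.coeff μ = 1 ∧ ∀ ν, ν ≠ μ → p.coeff ν ≠ 0 → w ν < w μ

theorem IsUnitriangularAt.one {R : Type*} [CommRing R] (w : (Fin n →₀ ℕ) →+ ℕ) :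
    IsUnitriangularAt w (1 : MvPolynomial (Fin n) R) 0 := by
  refine ⟨coeff_zero_one, fun ν hν h => (h ?_).elim⟩
  rw [coeff_one, if_neg hν.symm]

theorem IsUnitriangularAt.mul {R : Type*} [CommRing R] {w : (Fin n →₀ ℕ) →+ ℕ}
    {p r : MvPolynomial (Fin n) R} {μ ν : Fin n →₀ ℕ} (hp : IsUnitriangularAt w p μ)
    (hr : IsUnitriangularAt w r ν) : IsUnitriangularAt w (p * r) (μ + ν) := by
  classical
  have key : ∀ x : (Fin n →₀ ℕ) × (Fin n →₀ ℕ), x ≠ (μ, ν) → coeff x.1 p * coeff x.2 r ≠ 0 →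
      w (x.1 + x.2) < w (μ + ν) := by
    rintro ⟨a, b⟩ hne h0
    have ha := left_ne_zero_of_mul h0
    have hb := right_ne_zero_of_mul h0
    rw [map_add, map_add]
    by_cases h1 : a = μ
    · subst h1
      have := hr.2 b (by rintro rfl; exact hne rfl) hb
      simpa using this
    · have h2 := hp.2 a h1 ha
      by_cases h3 : b = ν
      · subst h3; simpa using h2
      · exact add_lt_add h2 (hr.2 b h3 hb)
  refine ⟨?_, fun κ hκ h => ?_⟩
  · rw [coeff_mul, Finset.sum_eq_single (μ, ν)]
    · simp [hp.1, hr.1]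
    · intro x hx hne
      by_contra h0
      have := key x hne h0
      rw [Finset.HasAntidiagonal.mem_antidiagonal.1 hx] at this
      exact lt_irrefl _ this
    · simp
  · rw [coeff_mul] at h
    obtain ⟨x, hx, h0⟩ := Finset.exists_ne_zero_of_sum_ne_zero h
    have hx' := Finset.HasAntidiagonal.mem_antidiagonal.1 hx
    rw [← hx']
    refine key x ?_ h0
    rintro rfl
    exact hκ hx'.symm

theorem IsUnitriangularAt.prod {R ι : Type*} [CommRing R] {w : (Fin n →₀ ℕ) →+ ℕ}
    {p : ι → MvPolynomial (Fin n) R} {μ : ι → Fin n →₀ ℕ} (s : Finset ι)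
    (h : ∀ i ∈ s, IsUnitriangularAt w (p i) (μ i)) :
    IsUnitriangularAt w (∏ i ∈ s, p i) (∑ i ∈ s, μ i) := by
  classical
  induction s using Finset.induction_on with
  | empty => exact IsUnitriangularAt.one w
  | insert a s ha ih =>
    rw [Finset.prod_insert ha, Finset.sum_insert ha]
    exact (h a (Finset.mem_insert_self _ _)).mul
      (ih fun i hi => h i (Finset.mem_insert_of_mem hi))

theorem linearIndependent_of_isUnitriangularAt (w : (Fin n →₀ ℕ) →+ ℕ)
    (h : ∀ μ, IsUnitriangularAt w (P μ) μ) : LinearIndependent K P := by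
  classical
  rw [linearIndependent_iff']
  intro s g hg
  by_contra! hne
  obtain ⟨μ₀, hμ₀s, hμ₀⟩ := hne
  obtain ⟨μ, hμ, hmax⟩ := Finset.exists_max_image {ν ∈ s | g ν ≠ 0} w
    ⟨μ₀, Finset.mem_filter.2 ⟨hμ₀s, hμ₀⟩⟩
  rw [Finset.mem_filter] at hμ
  refine hμ.2 ?_
  have h0 := congrArg (coeff μ) hg
  rw [coeff_sum, coeff_zero, Finset.sum_eq_single μ] at h0
  · simpa [(h μ).1] using h0
  · intro ν hν hνμ
    rw [coeff_smul]
    by_contra hc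
    have := (h ν).2 μ hνμ.symm (right_ne_zero_of_smul hc)
    exact absurd (hmax ν (Finset.mem_filter.2 ⟨hν, left_ne_zero_of_smul hc⟩)) (not_le.2 this)
  · exact fun h => absurd hμ.1 h

end Families

section Lefschetz

variable {n : ℕ}

/-- The products of powers of `f` and monomials below `d`, indexed by exponents. -/
noncomputable def powerFamily {R : Type*} [CommRing R] (d : Fin n → ℕ)
    (f : Fin n → MvPolynomial (Fin n) R) (μ : Fin n →₀ ℕ) : MvPolynomial (Fin n) R :=
  ∏ j, f j ^ (μ j / d j) * X j ^ (μ j % d j)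

/-- The exponent vector of the socle monomial of the complete intersection of the `x_j ^ d_j`. -/
noncomputable def socleExp (d : Fin n → ℕ) : Fin n →₀ ℕ :=
  Finsupp.equivFunOnFinite.symm fun j => d j - 1

/-- The modification of `powerFamily d f` in which the monomials below `d` of degree `D + i` are
replaced by the products of `x_l ^ D` with the monomials below `d` of degree `i`. -/
noncomputable def lefschetzFamily {R : Type*} [CommRing R] (d : Fin n → ℕ) (l : Fin n) (i D : ℕ)
    (f : Fin n → MvPolynomial (Fin n) R) (μ : Fin n →₀ ℕ) : MvPolynomial (Fin n) R :=
  open scoped Classical in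
  if μ ∈ degExps n (D + i) \ largeExps d then X l ^ D * powerFamily d f (socleExp d - μ)
  else powerFamily d f μ

theorem map_powerFamily {R S : Type*} [CommRing R] [CommRing S] (φ : R →+* S) (d : Fin n → ℕ)
    (f : Fin n → MvPolynomial (Fin n) R) (μ : Fin n →₀ ℕ) :
    map φ (powerFamily d f μ) = powerFamily d (fun j => map φ (f j)) μ := by
  simp [powerFamily, map_prod]

theorem map_lefschetzFamily {R S : Type*} [CommRing R] [CommRing S] (φ : R →+* S) (d : Fin n → ℕ)
    (l : Fin n) (i D : ℕ) (f : Fin n → MvPolynomial (Fin n) R) (μ : Fin n →₀ ℕ) :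
    map φ (lefschetzFamily d l i D f μ) = lefschetzFamily d l i D (fun j => map φ (f j)) μ := by
  rw [lefschetzFamily, lefschetzFamily]
  split_ifs <;> simp [map_powerFamily]

theorem isHomogeneous_powerFamily {R : Type*} [CommRing R] {d : Fin n → ℕ}
    {f : Fin n → MvPolynomial (Fin n) R} (hf : ∀ j, (f j).IsHomogeneous (d j)) (μ : Fin n →₀ ℕ) :
    (powerFamily d f μ).IsHomogeneous μ.degree := by
  rw [Finsupp.degree_eq_sum]
  refine IsHomogeneous.prod _ _ _ fun j _ => ?_
  have := ((hf j).pow (μ j / d j)).mul (isHomogeneous_X_pow (R := R) j (μ j % d j))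
  rwa [Nat.div_add_mod] at this

theorem degree_socleExp_sub_add {d : Fin n → ℕ} {μ : Fin n →₀ ℕ} (hμ : μ ∉ largeExps d) :
    (socleExp d - μ).degree + μ.degree = ∑ j, (d j - 1) := by
  have h : socleExp d - μ + μ = socleExp d := by
    refine tsub_add_cancel_of_le fun j => ?_
    have : ¬ d j ≤ μ j := fun h => hμ ⟨j, h⟩
    simp [socleExp]
    omega
  rw [← map_add, h, Finsupp.degree_eq_sum]
  simp [socleExp]

theorem degree_socleExp_sub {d : Fin n → ℕ} {μ : Fin n →₀ ℕ} (hμ : μ ∉ largeExps d) {i D : ℕ}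
    (hdeg : μ.degree = D + i) (hD : D + 2 * i = ∑ j, (d j - 1)) :
    (socleExp d - μ).degree = i := by
  have := degree_socleExp_sub_add hμ
  omega

theorem socleExp_sub_sub {d : Fin n → ℕ} {μ : Fin n →₀ ℕ} (hμ : μ ∉ largeExps d) :
    socleExp d - (socleExp d - μ) = μ := by
  ext j
  have : ¬ d j ≤ μ j := fun h => hμ ⟨j, h⟩
  simp [socleExp]
  omega

theorem socleExp_sub_notMem (d : Fin n → ℕ) (hd : ∀ j, 1 ≤ d j) (μ : Fin n →₀ ℕ) :
    socleExp d - μ ∉ largeExps d := by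
  rintro ⟨j, hj⟩
  have := hd j
  simp [socleExp] at hj
  omega

theorem isHomogeneous_lefschetzFamily {R : Type*} [CommRing R] {d : Fin n → ℕ} (l : Fin n)
    {i D : ℕ} (hD : D + 2 * i = ∑ j, (d j - 1)) {f : Fin n → MvPolynomial (Fin n) R}
    (hf : ∀ j, (f j).IsHomogeneous (d j)) (μ : Fin n →₀ ℕ) :
    (lefschetzFamily d l i D f μ).IsHomogeneous μ.degree := by
  rw [lefschetzFamily]
  split_ifs with h
  · have h2 := (isHomogeneous_X_pow (R := R) l D).mul (isHomogeneous_powerFamily hf (socleExp d - μ))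
    rwa [degree_socleExp_sub h.2 h.1 hD, ← show Finsupp.degree μ = D + i from h.1] at h2
  · exact isHomogeneous_powerFamily hf μ

variable {K : Type*} [Field K] {d : Fin n → ℕ} {f : Fin n → MvPolynomial (Fin n) K}

theorem homogeneousComponent_mem_span {P : (Fin n →₀ ℕ) → MvPolynomial (Fin n) K}
    (hP : ∀ μ, (P μ).IsHomogeneous μ.degree) {s : Set (Fin n →₀ ℕ)} {p : MvPolynomial (Fin n) K}
    (hp : p ∈ Submodule.span K (P '' s)) (t : ℕ) :
    homogeneousComponent t p ∈ Submodule.span K (P '' (s ∩ degExps n t)) := by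
  refine (Submodule.map_span_le (homogeneousComponent t) (P '' s) _).2 ?_
    (Submodule.mem_map_of_mem hp)
  rintro _ ⟨μ, hμ, rfl⟩
  rw [homogeneousComponent_of_mem ((mem_homogeneousSubmodule _ _).2 (hP μ))]
  split_ifs with h
  · exact Submodule.subset_span ⟨μ, ⟨hμ, h.symm⟩, rfl⟩
  · exact Submodule.zero_mem _

theorem mul_powerFamily (hd : ∀ j, 1 ≤ d j) (j : Fin n) (μ : Fin n →₀ ℕ) :
    f j * powerFamily d f μ = powerFamily d f (μ + Finsupp.single j (d j)) := by
  rw [powerFamily, powerFamily, ← Finset.mul_prod_erase _ _ (Finset.mem_univ j),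
    ← Finset.mul_prod_erase _ _ (Finset.mem_univ j), ← mul_assoc]
  congr 1
  · simp [Nat.add_div_right _ (hd j), pow_succ']
    ring
  · refine Finset.prod_congr rfl fun k hk => ?_
    have : j ≠ k := (Finset.ne_of_mem_erase hk).symm
    simp [this]

theorem span_powerFamily_largeExps (hd : ∀ j, 1 ≤ d j)
    (hG : Submodule.span K (Set.range (powerFamily d f)) = ⊤) :
    Submodule.span K (powerFamily d f '' largeExps d) =
      (Ideal.span (Set.range f)).restrictScalars K := by
  refine le_antisymm (Submodule.span_le.2 ?_) fun p hp => ?_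
  · rintro _ ⟨μ, ⟨j, hj⟩, rfl⟩
    refine Ideal.mem_of_dvd _ ?_ (Ideal.subset_span ⟨j, rfl⟩)
    refine Dvd.dvd.trans ?_ (Finset.dvd_prod_of_mem _ (Finset.mem_univ j))
    exact Dvd.dvd.mul_right (dvd_pow_self _ (Nat.div_pos hj (hd j)).ne') _
  · obtain ⟨c, rfl⟩ := Ideal.mem_span_range_iff_exists_fun.1 hp
    refine Submodule.sum_mem _ fun j _ => ?_
    have hc : c j ∈ Submodule.span K (Set.range (powerFamily d f)) := hG ▸ Submodule.mem_top
    refine (Submodule.map_span_le (LinearMap.mulRight K (f j)) _ _).2 ?_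
      (Submodule.mem_map_of_mem hc)
    rintro _ ⟨μ, rfl⟩
    rw [LinearMap.mulRight_apply, mul_comm, mul_powerFamily hd]
    exact Submodule.subset_span ⟨_, ⟨j, by simp⟩, rfl⟩

theorem linearIndepOn_lefschetzFamily (hd : ∀ j, 1 ≤ d j) (hf : ∀ j, (f j).IsHomogeneous (d j))
    (l : Fin n) {i D : ℕ} (hD : D + 2 * i = ∑ j, (d j - 1))
    (hG : LinearIndependent K (powerFamily d f))
    (hG' : Submodule.span K (Set.range (powerFamily d f)) = ⊤)
    (hinj : ∀ u : MvPolynomial (Fin n) K, u.IsHomogeneous i →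
      X l ^ D * u ∈ Ideal.span (Set.range f) → u ∈ Ideal.span (Set.range f)) :
    LinearIndepOn K (lefschetzFamily d l i D f) (degExps n (D + i)) := by
  have hJ := span_powerFamily_largeExps hd hG'
  have hA : Set.EqOn (fun μ => X l ^ D * powerFamily d f (socleExp d - μ))
      (lefschetzFamily d l i D f) (degExps n (D + i) \ largeExps d) := fun μ hμ => by
    rw [lefschetzFamily, if_pos hμ]
  have hB : Set.EqOn (powerFamily d f) (lefschetzFamily d l i D f)
      (degExps n (D + i) ∩ largeExps d) := fun μ hμ => by
    rw [lefschetzFamily, if_neg fun h => h.2 hμ.2]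
  rw [← Set.sdiff_union_inter (degExps n (D + i)) (largeExps d)]
  refine LinearIndepOn.union ?_ ((hG.linearIndepOn _).congr hB) ?_
  · refine LinearIndepOn.congr ?_ hA
    have h1 := hG.comp (fun μ : ↥(degExps n (D + i) \ largeExps d) => socleExp d - μ)
      fun μ ν h => by
        have := congrArg (socleExp d - ·) h
        simp only [socleExp_sub_sub μ.2.2, socleExp_sub_sub ν.2.2] at this
        exact Subtype.ext this
    refine h1.map' (LinearMap.mulLeft K (X l ^ D)) (LinearMap.ker_eq_bot.2 ?_)
    exact mul_right_injective₀ (pow_ne_zero _ (X_ne_zero l))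
  · rw [Submodule.disjoint_def]
    intro v hvA hvB
    have h1 : v ∈ (Submodule.span K (powerFamily d f '' ((largeExps d)ᶜ ∩ degExps n i))).map
        (LinearMap.mulLeft K (X l ^ D)) := by
      refine Submodule.span_le.2 ?_ hvA
      rintro _ ⟨μ, hμ, rfl⟩
      rw [← hA hμ]
      exact Submodule.mem_map_of_mem (Submodule.subset_span
        ⟨_, ⟨socleExp_sub_notMem d hd μ, degree_socleExp_sub hμ.2 hμ.1 hD⟩, rfl⟩)
    obtain ⟨u, hu, rfl⟩ := h1
    have hu1 : u.IsHomogeneous i := by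
      rw [← mem_homogeneousSubmodule]
      refine Submodule.span_le.2 ?_ hu
      rintro _ ⟨μ, hμ, rfl⟩
      have := isHomogeneous_powerFamily hf μ
      rwa [show Finsupp.degree μ = i from hμ.2] at this
    have hu2 : X l ^ D * u ∈ Ideal.span (Set.range f) := by
      rw [← Submodule.restrictScalars_mem K, ← hJ]
      refine Submodule.span_mono ?_ hvB
      rintro _ ⟨μ, hμ, rfl⟩
      exact ⟨μ, hμ.2, hB hμ⟩
    have hu3 := hinj u hu1 hu2
    rw [← Submodule.restrictScalars_mem K, ← hJ] at hu3
    have hu4 := Submodule.span_mono (Set.image_mono Set.inter_subset_left) hu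
    rw [Submodule.disjoint_def.1 (hG.disjoint_span_image disjoint_compl_left) u hu4 hu3, map_zero]

theorem mem_of_linearIndependent_lefschetzFamily (hd : ∀ j, 1 ≤ d j)
    (hf : ∀ j, (f j).IsHomogeneous (d j)) (l : Fin n) {i D : ℕ}
    (hD : D + 2 * i = ∑ j, (d j - 1))
    (hG' : Submodule.span K (Set.range (powerFamily d f)) = ⊤)
    (hH : LinearIndependent K (lefschetzFamily d l i D f))
    (u : MvPolynomial (Fin n) K) (hu : u.IsHomogeneous i)
    (h : X l ^ D * u ∈ Ideal.span (Set.range f)) : u ∈ Ideal.span (Set.range f) := by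
  have hJ := span_powerFamily_largeExps hd hG'
  have hGhom := isHomogeneous_powerFamily hf
  have htop : u ∈ Submodule.span K (powerFamily d f '' (largeExps d)ᶜ) ⊔
      Submodule.span K (powerFamily d f '' largeExps d) := by
    rw [← Submodule.span_union, ← Set.image_union, Set.compl_union_self, Set.image_univ, hG']
    exact Submodule.mem_top
  obtain ⟨a, ha, b, hb, hab⟩ := Submodule.mem_sup.1 htop
  have ha' := homogeneousComponent_mem_span hGhom ha i
  have hb' : homogeneousComponent i b ∈ Ideal.span (Set.range f) := by
    rw [← Submodule.restrictScalars_mem K, ← hJ]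
    exact Submodule.span_mono (Set.image_mono Set.inter_subset_left)
      (homogeneousComponent_mem_span hGhom hb i)
  have hu' : homogeneousComponent i a + homogeneousComponent i b = u := by
    rw [← map_add, hab, homogeneousComponent_of_mem ((mem_homogeneousSubmodule _ _).2 hu), if_pos rfl]
  set a' := homogeneousComponent i a
  set b' := homogeneousComponent i b
  have h1 : X l ^ D * a' ∈ Submodule.span K (lefschetzFamily d l i D f '' largeExps d) := by
    have hEq : Set.EqOn (powerFamily d f) (lefschetzFamily d l i D f) (largeExps d) :=
      fun μ hμ => by rw [lefschetzFamily, if_neg fun h => h.2 hμ]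
    rw [← hEq.image_eq, hJ, Submodule.restrictScalars_mem]
    have : X l ^ D * a' = X l ^ D * u - X l ^ D * b' := by rw [← hu']; ring
    rw [this]
    exact Ideal.sub_mem _ h (Ideal.mul_mem_left _ _ hb')
  have h2 : X l ^ D * a' ∈ Submodule.span K (lefschetzFamily d l i D f '' (largeExps d)ᶜ) := by
    refine (Submodule.map_span_le (LinearMap.mulLeft K (X l ^ D)) _ _).2 ?_
      (Submodule.mem_map_of_mem ha')
    rintro _ ⟨μ, hμ, rfl⟩
    have hsub : socleExp d - μ ∈ degExps n (D + i) \ largeExps d := by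
      refine ⟨?_, socleExp_sub_notMem d hd μ⟩
      have h3 := degree_socleExp_sub_add hμ.1
      have h4 : Finsupp.degree μ = i := hμ.2
      show Finsupp.degree _ = D + i
      omega
    refine Submodule.subset_span ⟨socleExp d - μ, hsub.2, ?_⟩
    rw [lefschetzFamily, if_pos hsub, socleExp_sub_sub hμ.1, LinearMap.mulLeft_apply]
  have h3 := Submodule.disjoint_def.1 (hH.disjoint_span_image disjoint_compl_left) _ h2 h1
  rw [mul_eq_zero, or_iff_right (pow_ne_zero _ (X_ne_zero l))] at h3
  rw [← hu', h3, zero_add]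
  exact hb'

end Lefschetz

section SpecialPoint

variable {n : ℕ} {K : Type*} [Field K]

/-- The variable of index `k - 1`, or `0` if there is none. -/
noncomputable def varBefore (K : Type*) [Field K] (n : ℕ) : ℕ → MvPolynomial (Fin n) K
  | 0 => 0
  | k + 1 => if h : k < n then X ⟨k, h⟩ else 0

/-- The `q`-analogue of the power `x_j ^ m`. -/
noncomputable def quantumPow (q : K) (j : Fin n) (m : ℕ) : MvPolynomial (Fin n) K :=
  ∏ k ∈ Finset.range m, (X j - C (q ^ k) * varBefore K n j)

/-- The `q`-analogues of the monomials. -/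
noncomputable def quantumMonomial (q : K) (b : Fin n →₀ ℕ) : MvPolynomial (Fin n) K :=
  ∏ j, quantumPow q j (b j)

/-- The weight of an exponent vector in which the variable of index `j` has weight `j`. -/
noncomputable def indexWeight (n : ℕ) : (Fin n →₀ ℕ) →+ ℕ := Finsupp.weight fun j : Fin n => (j : ℕ)

theorem isHomogeneous_varBefore (k : ℕ) : (varBefore K n k).IsHomogeneous 1 := by
  cases k with
  | zero => exact isHomogeneous_zero _ _ _
  | succ k =>
    rw [varBefore]
    split_ifs
    · exact isHomogeneous_X _ _
    · exact isHomogeneous_zero _ _ _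

theorem isHomogeneous_quantumPow (q : K) (j : Fin n) (m : ℕ) :
    (quantumPow q j m).IsHomogeneous m := by
  have := IsHomogeneous.prod (Finset.range m)
    (fun k => X j - C (q ^ k) * varBefore K n j) (fun _ => 1) fun k _ =>
      (isHomogeneous_X K j).sub ((isHomogeneous_varBefore (K := K) (j : ℕ)).C_mul (q ^ k))
  simpa [quantumPow] using this

theorem isHomogeneous_quantumMonomial (q : K) (b : Fin n →₀ ℕ) :
    (quantumMonomial q b).IsHomogeneous b.degree := by
  rw [Finsupp.degree_eq_sum]
  exact IsHomogeneous.prod _ _ _ fun j _ => isHomogeneous_quantumPow q j _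

theorem isUnitriangularAt_X_sub (c : K) (j : Fin n) :
    IsUnitriangularAt (indexWeight n) (X j - C c * varBefore K n j) (Finsupp.single j 1) := by
  obtain ⟨k, hk⟩ := j
  cases k with
  | zero =>
    refine ⟨by simp [varBefore], fun ν hν h => ?_⟩
    simp [varBefore, coeff_X, hν.symm] at h
  | succ k =>
    have hne : (⟨k, Nat.lt_of_succ_lt hk⟩ : Fin n) ≠ ⟨k + 1, hk⟩ := by simp
    have hne' : (Finsupp.single ⟨k, Nat.lt_of_succ_lt hk⟩ 1 : Fin n →₀ ℕ) ≠
        Finsupp.single ⟨k + 1, hk⟩ 1 :=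
      fun h => hne (Finsupp.single_left_injective one_ne_zero h)
    refine ⟨by simp [varBefore, Nat.lt_of_succ_lt hk, coeff_X, hne'], fun ν hν h => ?_⟩
    simp [varBefore, Nat.lt_of_succ_lt hk, coeff_X, hν.symm] at h
    rw [← h.1]
    simp [indexWeight, Finsupp.weight_single]

theorem isUnitriangularAt_quantumPow (q : K) (j : Fin n) (m : ℕ) :
    IsUnitriangularAt (indexWeight n) (quantumPow q j m) (Finsupp.single j m) := by
  have := IsUnitriangularAt.prod (Finset.range m)
    fun k _ => isUnitriangularAt_X_sub (n := n) (q ^ k) j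
  simpa [quantumPow] using this

theorem isUnitriangularAt_quantumMonomial (q : K) (b : Fin n →₀ ℕ) :
    IsUnitriangularAt (indexWeight n) (quantumMonomial q b) b := by
  have := IsUnitriangularAt.prod Finset.univ
    fun j _ => isUnitriangularAt_quantumPow (n := n) q j (b j)
  rwa [Finsupp.univ_sum_single] at this

theorem isUnitriangularAt_powerFamily (q : K) (d : Fin n → ℕ) (μ : Fin n →₀ ℕ) :
    IsUnitriangularAt (indexWeight n) (powerFamily d (fun j => quantumPow q j (d j)) μ) μ := by
  have := IsUnitriangularAt.prod Finset.univ fun j _ =>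
    (IsUnitriangularAt.prod (Finset.range (μ j / d j))
      fun _ _ => isUnitriangularAt_quantumPow (n := n) q j (d j)).mul
    (IsUnitriangularAt.prod (Finset.range (μ j % d j))
      fun _ _ => isUnitriangularAt_X_sub (n := n) (0 : K) j)
  simp only [Finset.prod_const, Finset.sum_const, Finset.card_range, C_0, zero_mul, sub_zero,
    Finsupp.smul_single, ← Finsupp.single_add, smul_eq_mul, mul_one, Nat.div_add_mod',
    Finsupp.univ_sum_single] at this
  exact this

theorem linearIndependent_quantumMonomial (q : K) :
    LinearIndependent K (quantumMonomial q : (Fin n →₀ ℕ) → MvPolynomial (Fin n) K) :=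
  linearIndependent_of_isUnitriangularAt _ (isUnitriangularAt_quantumMonomial q)

theorem varBefore_mul_quantumMonomial (q : K) (j : Fin n) (b : Fin n →₀ ℕ) :
    X j * quantumMonomial q b = quantumMonomial q (b + Finsupp.single j 1) +
      varBefore K n j * q ^ b j • quantumMonomial q b := by
  have h : quantumMonomial q (b + Finsupp.single j 1) =
      (X j - C (q ^ b j) * varBefore K n j) * quantumMonomial q b := by
    rw [quantumMonomial, quantumMonomial, ← Finset.mul_prod_erase _ _ (Finset.mem_univ j),
      ← Finset.mul_prod_erase _ _ (Finset.mem_univ j), ← mul_assoc]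
    congr 1
    · simp [quantumPow, Finset.prod_range_succ, mul_comm]
    · refine Finset.prod_congr rfl fun k hk => ?_
      simp [(Finset.ne_of_mem_erase hk).symm]
  rw [h, smul_eq_C_mul]
  ring

theorem varBefore_mul_linearCombination (q : K) (k : ℕ) (m : (Fin n →₀ ℕ) →₀ K) :
    varBefore K n k * Finsupp.linearCombination K (quantumMonomial q) m =
      Finsupp.linearCombination K (quantumMonomial q) (raiseOp q k m) := by
  induction k generalizing m with
  | zero => simp [varBefore, raiseOp]
  | succ k ih =>
    rw [varBefore, raiseOp]
    split_ifs with h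
    · induction m using Finsupp.induction_linear with
      | zero => simp
      | add m₁ m₂ h₁ h₂ => rw [map_add, map_add, map_add, mul_add, h₁, h₂]
      | single b r =>
        have hc : Commute (scaleOp q ⟨k, h⟩) (raiseOp q k) :=
          commute_raiseOp q _ k (fun j hj => commute_scaleOp_upOp q (by rintro rfl; simp at hj))
            fun j hj => commute_scaleOp_scaleOp q
        rw [hc.eq, LinearMap.add_apply, Module.End.mul_apply, map_add, ← ih, upOp_single,
          scaleOp_single, Finsupp.linearCombination_single, Finsupp.linearCombination_single,
          Finsupp.linearCombination_single, mul_smul_comm, varBefore_mul_quantumMonomial,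
          smul_add, mul_smul, mul_smul_comm, mul_smul_comm, mul_smul_comm]
    · simp

theorem X_pow_mul_linearCombination (q : K) (l : Fin n) (D : ℕ) (m : (Fin n →₀ ℕ) →₀ K) :
    X l ^ D * Finsupp.linearCombination K (quantumMonomial q) m =
      Finsupp.linearCombination K (quantumMonomial q) ((raiseOp q (l + 1) ^ D) m) := by
  induction D with
  | zero => simp
  | succ D ih =>
    rw [pow_succ', mul_assoc, ih, pow_succ', Module.End.mul_apply,
      ← varBefore_mul_linearCombination, varBefore, dif_pos l.2]

theorem linearCombination_mem_span_quantumPow_iff (q : K) (d : Fin n → ℕ)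
    (m : (Fin n →₀ ℕ) →₀ K) :
    Finsupp.linearCombination K (quantumMonomial q) m ∈
        Ideal.span (Set.range fun j => quantumPow q j (d j)) ↔
      m ∈ Finsupp.supported K K (largeExps d) := by
  constructor
  · intro h
    have hmul : ∀ p : MvPolynomial (Fin n) K, ∀ v ∈ (Finsupp.supported K K (largeExps d)).map
        (Finsupp.linearCombination K (quantumMonomial q)),
        p * v ∈ (Finsupp.supported K K (largeExps d)).map
          (Finsupp.linearCombination K (quantumMonomial q)) := by
      intro p
      induction p using MvPolynomial.induction_on with
      | C a => exact fun v hv => by rw [← smul_eq_C_mul]; exact Submodule.smul_mem _ _ hv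
      | add p₁ p₂ h₁ h₂ =>
        exact fun v hv => by rw [add_mul]; exact Submodule.add_mem _ (h₁ v hv) (h₂ v hv)
      | mul_X p l hp =>
        rintro _ ⟨u, hu, rfl⟩
        rw [mul_assoc, ← pow_one (X l), X_pow_mul_linearCombination, pow_one]
        refine hp _ (Submodule.mem_map_of_mem (raiseOp_mem_supported q (fun b hb j => ?_) _ hu))
        obtain ⟨t, ht⟩ := hb
        exact ⟨t, ht.trans (by simp)⟩
    obtain ⟨c, hc⟩ := Ideal.mem_span_range_iff_exists_fun.1 h
    have h1 : Finsupp.linearCombination K (quantumMonomial q) m ∈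
        (Finsupp.supported K K (largeExps d)).map
          (Finsupp.linearCombination K (quantumMonomial q)) := by
      rw [← hc]
      refine Submodule.sum_mem _ fun j _ => hmul _ _ ?_
      refine ⟨Finsupp.single (Finsupp.single j (d j)) 1,
        Finsupp.single_mem_supported K _ ⟨j, by simp⟩, ?_⟩
      rw [Finsupp.linearCombination_single, one_smul, quantumMonomial, Finset.prod_eq_single j]
      · simp
      · intro k _ hk
        simp [quantumPow, hk.symm]
      · simp
    obtain ⟨u, hu, hum⟩ := h1
    rwa [← linearIndependent_quantumMonomial q hum]
  · intro h
    rw [Finsupp.linearCombination_apply]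
    refine Ideal.sum_mem _ fun b hb => ?_
    obtain ⟨j, hj⟩ := h hb
    dsimp only
    rw [smul_eq_C_mul]
    refine Ideal.mul_mem_left _ _ (Ideal.mem_of_dvd _ ?_ (Ideal.subset_span ⟨j, rfl⟩))
    refine Dvd.dvd.trans ?_ (Finset.dvd_prod_of_mem _ (Finset.mem_univ j))
    exact Finset.prod_dvd_prod_of_subset _ _ _ (Finset.range_subset_range.2 hj)

/-- The strong Lefschetz property of the last variable modulo the ideal of the `q`-powers. -/
theorem mem_span_quantumPow_of_X_pow_mul_mem (q : K) (d : Fin n → ℕ) (hd : ∀ j, 1 ≤ d j)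
    (hq0 : q ≠ 0) (hq : ∀ m, 0 < m → m ≤ ∑ j, (d j - 1) + 1 → q ^ m ≠ 1) (i D : ℕ)
    (hD : D + 2 * i ≤ ∑ j, (d j - 1)) (l : Fin n) (hl : (l : ℕ) + 1 = n)
    (u : MvPolynomial (Fin n) K) (hu : u.IsHomogeneous i)
    (h : X l ^ D * u ∈ Ideal.span (Set.range fun j => quantumPow q j (d j))) :
    u ∈ Ideal.span (Set.range fun j => quantumPow q j (d j)) := by
  have hspan := span_range_eq_top_of_linearIndepOn (isHomogeneous_quantumMonomial (n := n) q)
    fun t => (linearIndependent_quantumMonomial q).linearIndepOn _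
  have h1 : u ∈ Submodule.span K (quantumMonomial q '' Set.univ) := by
    rw [Set.image_univ, hspan]
    exact Submodule.mem_top
  have h2 := homogeneousComponent_mem_span (isHomogeneous_quantumMonomial q) h1 i
  rw [homogeneousComponent_of_mem ((mem_homogeneousSubmodule _ _).2 hu), if_pos rfl,
    Set.univ_inter, Finsupp.mem_span_image_iff_linearCombination] at h2
  obtain ⟨m, hm, rfl⟩ := h2
  rw [X_pow_mul_linearCombination, linearCombination_mem_span_quantumPow_iff, hl] at h
  rw [linearCombination_mem_span_quantumPow_iff]
  exact mem_supported_of_raiseOp_pow q d hd hq0 hq i D hD m hm h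

end SpecialPoint

section Generic

variable {n : ℕ}

theorem expDeg_eq_degree (μ : Fin n →₀ ℕ) : expDeg μ = μ.degree := rfl

noncomputable instance (t : ℕ) : Fintype {μ : Fin n →₀ ℕ // expDeg μ = t} :=
  (Finsupp.finite_of_degree_eq t).fintype

/-- The sequence of forms of degrees `d` whose coefficients are distinct variables. -/
noncomputable def universalForm (F : Type*) [CommRing F] (d : Fin n → ℕ) (j : Fin n) :
    MvPolynomial (Fin n) (MvPolynomial (Σ i : Fin n, {μ : Fin n →₀ ℕ // expDeg μ = d i}) F) :=
  ∑ μ : {μ : Fin n →₀ ℕ // expDeg μ = d j}, monomial μ.1 (X ⟨j, μ⟩)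

variable {F K : Type*} [Field F] [Field K] [Algebra F K]

theorem map_universalForm {d : Fin n → ℕ} {g : Fin n → MvPolynomial (Fin n) K}
    (hg : ∀ j, (g j).IsHomogeneous (d j)) (j : Fin n) :
    map (aeval (R := F) fun p : Σ i : Fin n, {μ : Fin n →₀ ℕ // expDeg μ = d i} =>
      (g p.1).coeff p.2.1).toRingHom (universalForm F d j) = g j := by
  ext ν
  simp only [universalForm, map_sum, map_monomial, coeff_sum, coeff_monomial]
  by_cases hν : expDeg ν = d j
  · rw [Finset.sum_eq_single ⟨ν, hν⟩]
    · simp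
    · exact fun μ _ hμ => if_neg fun h => hμ (Subtype.ext h)
    · simp
  · rw [(hg j).coeff_eq_zero hν]
    refine Finset.sum_eq_zero fun μ _ => if_neg ?_
    rintro rfl
    exact hν μ.2

theorem det_coeffMatrix_ne_zero_of_isGenericSeq {d : Fin n → ℕ}
    {f g : Fin n → MvPolynomial (Fin n) K} (hf : IsGenericSeq F d f)
    (hg : ∀ j, (g j).IsHomogeneous (d j))
    (P : (Fin n →₀ ℕ) →
      MvPolynomial (Fin n) (MvPolynomial (Σ i : Fin n, {μ : Fin n →₀ ℕ // expDeg μ = d i}) F))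
    (Q : (Fin n → MvPolynomial (Fin n) K) → (Fin n →₀ ℕ) → MvPolynomial (Fin n) K)
    (hPQ : ∀ (φ : MvPolynomial (Σ i : Fin n, {μ : Fin n →₀ ℕ // expDeg μ = d i}) F →+* K) μ,
      map φ (P μ) = Q (fun j => map φ (universalForm F d j)) μ)
    (t : ℕ) (h : (coeffMatrix (Q g) t).det ≠ 0) : (coeffMatrix (Q f) t).det ≠ 0 := by
  have key : ∀ g : Fin n → MvPolynomial (Fin n) K, (∀ j, (g j).IsHomogeneous (d j)) →
      aeval (R := F) (fun p : Σ i : Fin n, {μ : Fin n →₀ ℕ // expDeg μ = d i} =>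
        (g p.1).coeff p.2.1) (coeffMatrix P t).det = (coeffMatrix (Q g) t).det := by
    intro g hg
    have := map_det_coeffMatrix (aeval (R := F)
      fun p : Σ i : Fin n, {μ : Fin n →₀ ℕ // expDeg μ = d i} =>
        (g p.1).coeff p.2.1).toRingHom P t
    simp only [hPQ, map_universalForm hg] at this
    exact this
  rw [← key f hf.1, Ne, map_eq_zero_iff _ hf.2]
  rw [← key g hg] at h
  exact fun h0 => h (by rw [h0, map_zero])

theorem exists_pow_ne_one (K : Type*) [Field K] [Infinite K] (N : ℕ) :
    ∃ q : K, q ≠ 0 ∧ ∀ m, 0 < m → m ≤ N → q ^ m ≠ 1 := by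
  classical
  obtain ⟨q, hq⟩ := Infinite.exists_notMem_finset (insert (0 : K)
    ((Finset.range (N + 1)).biUnion fun m => (Polynomial.nthRoots m (1 : K)).toFinset))
  simp only [Finset.mem_insert, Finset.mem_biUnion, Finset.mem_range, Multiset.mem_toFinset,
    not_or, not_exists, not_and] at hq
  exact ⟨q, hq.1, fun m hm hmN h =>
    hq.2 m (Nat.lt_succ_of_le hmN) ((Polynomial.mem_nthRoots hm).2 h)⟩

/-- The strong Lefschetz property of the last variable modulo a generic complete intersection. -/
theorem mem_span_of_X_pow_mul_mem_of_isGenericSeq [Infinite K] {d : Fin n → ℕ}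
    (hd : ∀ j, 1 ≤ d j) {f : Fin n → MvPolynomial (Fin n) K} (hf : IsGenericSeq F d f)
    (l : Fin n) (hl : (l : ℕ) + 1 = n) (i D : ℕ) (hD : D + 2 * i ≤ ∑ j, (d j - 1))
    (u : MvPolynomial (Fin n) K) (hu : u.IsHomogeneous i)
    (h : X l ^ D * u ∈ Ideal.span (Set.range f)) : u ∈ Ideal.span (Set.range f) := by
  obtain ⟨q, hq0, hq⟩ := exists_pow_ne_one K (∑ j, (d j - 1) + 1)
  set E := ∑ j, (d j - 1) - 2 * i with hE
  have hED : E + 2 * i = ∑ j, (d j - 1) := by omega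
  have hE' : X l ^ E * u ∈ Ideal.span (Set.range f) := by
    rw [show E = (E - D) + D by omega, pow_add, mul_assoc]
    exact Ideal.mul_mem_left _ _ h
  set g : Fin n → MvPolynomial (Fin n) K := fun j => quantumPow q j (d j)
  have hg : ∀ j, (g j).IsHomogeneous (d j) := fun j => isHomogeneous_quantumPow q j _
  have hgG : LinearIndependent K (powerFamily d g) :=
    linearIndependent_of_isUnitriangularAt _ (isUnitriangularAt_powerFamily q d)
  have hfG : ∀ t, LinearIndepOn K (powerFamily d f) (degExps n t) := fun t => by
    rw [linearIndepOn_iff_det_ne_zero (isHomogeneous_powerFamily hf.1)]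
    refine det_coeffMatrix_ne_zero_of_isGenericSeq hf hg (powerFamily d (universalForm F d))
      (powerFamily d) (fun φ μ => map_powerFamily φ _ _ μ) t ?_
    rw [← linearIndepOn_iff_det_ne_zero (isHomogeneous_powerFamily hg)]
    exact hgG.linearIndepOn _
  have hfH : ∀ t, LinearIndepOn K (lefschetzFamily d l i E f) (degExps n t) := fun t => by
    by_cases ht : t = E + i
    · subst ht
      rw [linearIndepOn_iff_det_ne_zero (isHomogeneous_lefschetzFamily l hED hf.1)]
      refine det_coeffMatrix_ne_zero_of_isGenericSeq hf hg
        (lefschetzFamily d l i E (universalForm F d)) (lefschetzFamily d l i E)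
        (fun φ μ => map_lefschetzFamily φ _ _ _ _ _ μ) _ ?_
      rw [← linearIndepOn_iff_det_ne_zero (isHomogeneous_lefschetzFamily l hED hg)]
      exact linearIndepOn_lefschetzFamily hd hg l hED hgG
        (span_range_eq_top_of_linearIndepOn (isHomogeneous_powerFamily hg)
          fun t => hgG.linearIndepOn _)
        (fun u hu h => mem_span_quantumPow_of_X_pow_mul_mem q d hd hq0 hq i E hED.le l hl u hu h)
    · refine (hfG t).congr fun μ hμ => ?_
      rw [lefschetzFamily, if_neg]
      rintro ⟨h1, -⟩
      exact ht ((show Finsupp.degree μ = t from hμ).symm.trans h1)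
  exact mem_of_linearIndependent_lefschetzFamily hd hf.1 l hED
    (span_range_eq_top_of_linearIndepOn (isHomogeneous_powerFamily hf.1) hfG)
    (linearIndependent_of_linearIndepOn (isHomogeneous_lefschetzFamily l hED hf.1) hfH) u hu hE'

end Generic

section InitialIdeal

variable {n : ℕ} {K : Type*} [Field K]

theorem drlLT_add_right_iff {a b c : Fin n →₀ ℕ} : DrlLT (a + c) (b + c) ↔ DrlLT a b := by
  simp [DrlLT, expDeg_eq_degree]

theorem homogeneousComponent_mem_span_range {d : Fin n → ℕ} {f : Fin n → MvPolynomial (Fin n) K}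
    (hf : ∀ j, (f j).IsHomogeneous (d j)) {p : MvPolynomial (Fin n) K}
    (hp : p ∈ Ideal.span (Set.range f)) (t : ℕ) :
    homogeneousComponent t p ∈ Ideal.span (Set.range f) := by
  let _ : GradedAlgebra (homogeneousSubmodule (Fin n) K) := MvPolynomial.gradedAlgebra
  have h := Ideal.homogeneous_span (homogeneousSubmodule (Fin n) K) (Set.range f)
    (by rintro _ ⟨j, rfl⟩; exact ⟨d j, hf j⟩)
  exact homogeneousComponent_mem_of_mem h hp t

theorem monomial_mem_initialIdeal_iff {I : Ideal (MvPolynomial (Fin n) K)} {μ : Fin n →₀ ℕ} :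
    monomial μ (1 : K) ∈ initialIdeal I ↔ ∃ p ∈ I, IsLeadExp p μ := by
  have h : initialIdeal I = Ideal.span ((fun s => monomial s (1 : K)) ''
      {ν | ∃ p ∈ I, IsLeadExp p ν}) := by
    rw [initialIdeal]
    congr 1
    ext m
    constructor
    · rintro ⟨p, hp, -, ν, hν, rfl⟩
      exact ⟨ν, ⟨p, hp, hν⟩, rfl⟩
    · rintro ⟨ν, ⟨p, hp, hν⟩, rfl⟩
      refine ⟨p, hp, ?_, ν, hν, rfl⟩
      rintro rfl
      simp [IsLeadExp] at hν
  rw [h, mem_ideal_span_monomial_image]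
  constructor
  · intro hμ
    obtain ⟨ν, ⟨p, hp, hν⟩, hle⟩ := hμ μ (by simp)
    obtain ⟨κ, rfl⟩ := exists_add_of_le hle
    refine ⟨monomial κ 1 * p, I.mul_mem_left _ hp, ?_, fun ξ hξ hne => ?_⟩
    · rw [mem_support_iff, add_comm, coeff_monomial_mul, one_mul]
      exact mem_support_iff.1 hν.1
    · rw [mem_support_iff, coeff_monomial_mul'] at hξ
      obtain ⟨hκ, h0⟩ := ite_ne_right_iff.1 hξ
      obtain ⟨η, rfl⟩ := exists_add_of_le hκ
      rw [add_tsub_cancel_left, one_mul] at h0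
      rw [add_comm κ, drlLT_add_right_iff]
      refine hν.2 η (mem_support_iff.2 h0) ?_
      rintro rfl
      exact hne (add_comm _ _)
  · rintro ⟨p, hp, hμ⟩ ξ hξ
    rw [mem_support_iff, coeff_monomial, ite_ne_right_iff] at hξ
    exact ⟨μ, ⟨p, hp, hμ⟩, hξ.1.le⟩

theorem IsLeadExp.homogeneousComponent {p : MvPolynomial (Fin n) K} {μ : Fin n →₀ ℕ}
    (h : IsLeadExp p μ) : IsLeadExp (homogeneousComponent μ.degree p) μ := by
  simp only [IsLeadExp, mem_support_iff, coeff_homogeneousComponent] at h ⊢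
  exact ⟨by simpa using h.1, fun ν hν => h.2 ν (ite_ne_right_iff.1 hν).2⟩

/-- If multiplication by a power of the last variable is injective modulo a homogeneous ideal in
some degree, then it preserves standard monomials of that degree. -/
theorem add_single_mem_stdMon {J : Ideal (MvPolynomial (Fin n) K)}
    (hJ : ∀ p ∈ J, ∀ t, homogeneousComponent t p ∈ J) {l : Fin n} (hl : ∀ j, j ≤ l) {i D : ℕ}
    (hinj : ∀ u : MvPolynomial (Fin n) K, u.IsHomogeneous i → X l ^ D * u ∈ J → u ∈ J)
    {μ : Fin n →₀ ℕ} (hμ : μ ∈ stdMon J i) : μ + Finsupp.single l D ∈ stdMon J (D + i) := by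
  have hdeg : μ.degree = i := hμ.1
  have hdeg' : (μ + Finsupp.single l D).degree = D + i := by
    rw [map_add, Finsupp.degree_single, hdeg, add_comm]
  refine ⟨hdeg', fun hmem => hμ.2 ?_⟩
  obtain ⟨p₀, hp₀, hlead₀⟩ := monomial_mem_initialIdeal_iff.1 hmem
  have hlead := hlead₀.homogeneousComponent
  have hp := hJ p₀ hp₀ (μ + Finsupp.single l D).degree
  have hhom := homogeneousComponent_isHomogeneous (μ + Finsupp.single l D).degree p₀
  rw [hdeg'] at hlead hp hhom
  set p := homogeneousComponent (D + i) p₀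
  have hdiv : ∀ κ, coeff κ p ≠ 0 → Finsupp.single l D ≤ κ := by
    intro κ hκ
    rw [Finsupp.single_le_iff]
    by_cases hne : κ = μ + Finsupp.single l D
    · simp [hne]
    · rcases hlead.2 κ (mem_support_iff.2 hκ) hne with h | ⟨-, j, hj, hj'⟩
      · have h1 : κ.degree = D + i := by
          by_contra h1
          exact hκ (hhom.coeff_eq_zero h1)
        rw [expDeg_eq_degree, expDeg_eq_degree, h1, hdeg'] at h
        exact absurd h (lt_irrefl _)
      · rcases (hl j).eq_or_lt with rfl | hjl
        · simp at hj
          omega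
        · simp [hj' l hjl]
  set u := p.divMonomial (Finsupp.single l D) with hu
  have hcoeff : ∀ κ, coeff κ u = coeff (κ + Finsupp.single l D) p := fun κ => by
    rw [hu, coeff_divMonomial, add_comm]
  have hpu : X l ^ D * u = p := by
    rw [X_pow_eq_monomial]
    ext κ
    rw [coeff_monomial_mul']
    split_ifs with h
    · rw [hcoeff, tsub_add_cancel_of_le h, one_mul]
    · by_contra h0
      exact h (hdiv κ (Ne.symm h0))
  have huhom : u.IsHomogeneous i := by
    intro κ hκ
    rw [hcoeff] at hκ
    have h : κ.degree = i := by
      have h : (κ + Finsupp.single l D).degree = D + i := by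
        by_contra h
        exact hκ (hhom.coeff_eq_zero h)
      rw [map_add, Finsupp.degree_single] at h
      omega
    rwa [Finsupp.degree_eq_weight_one] at h
  rw [monomial_mem_initialIdeal_iff]
  refine ⟨u, hinj u huhom (by rwa [hpu]), ?_, fun κ hκ hne => ?_⟩
  · rw [mem_support_iff, hcoeff]
    exact mem_support_iff.1 hlead.1
  · rw [mem_support_iff, hcoeff] at hκ
    exact drlLT_add_right_iff.1
      (hlead.2 _ (mem_support_iff.2 hκ) fun h => hne (add_right_cancel h))

theorem mem_stdMon_of_add_mem {J : Ideal (MvPolynomial (Fin n) K)} {μ ν : Fin n →₀ ℕ} {t : ℕ}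
    (h : μ + ν ∈ stdMon J t) : μ ∈ stdMon J μ.degree := by
  refine ⟨rfl, fun hμ => h.2 ?_⟩
  have := (initialIdeal J).mul_mem_left (monomial ν 1) hμ
  rwa [monomial_mul, one_mul, add_comm] at this

theorem finite_stdMon (J : Ideal (MvPolynomial (Fin n) K)) (t : ℕ) : (stdMon J t).Finite :=
  (Finsupp.finite_of_degree_eq t).subset fun _ h => h.1

end InitialIdeal

/-- for `d ≥ d_n`, `d ≥ 1` and `d + i ≤ δ − i`, one has `a_{d+i} ≥ a_i` and the
`a_i` smallest monomials of `B_{d+i}` are exactly the monomials of `x_n^d·B_i`. -/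
theorem stmt14 {F K : Type*} [Field F] [Field K] [Algebra F K] [Infinite K]
    {n : ℕ} (hn : 0 < n) (d : Fin n → ℕ) (hd : ∀ i, 1 ≤ d i) (hmono : Monotone d)
    (f : Fin n → MvPolynomial (Fin n) K) (hf : IsGenericSeq F d f)
    (J : Ideal (MvPolynomial (Fin n) K)) (hJ : J = Ideal.span (Set.range f))
    (δ : ℕ) (hδ : δ = (∑ j, d j) - n)
    (D : ℕ) (hD1 : 1 ≤ D) (hdD : ∀ i, d i ≤ D)
    (i : ℕ) (hi : D + i + i ≤ δ) :
    (stdMon J i).ncard ≤ (stdMon J (D + i)).ncard ∧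
    (fun ν => ν + Finsupp.single (⟨n - 1, by omega⟩ : Fin n) D) '' stdMon J i ⊆
      stdMon J (D + i) ∧
    ((fun ν => ν + Finsupp.single (⟨n - 1, by omega⟩ : Fin n) D) '' stdMon J i).ncard =
      (stdMon J i).ncard ∧
    ∀ s ∈ (fun ν => ν + Finsupp.single (⟨n - 1, by omega⟩ : Fin n) D) '' stdMon J i,
      ∀ b ∈ stdMon J (D + i) \
        (fun ν => ν + Finsupp.single (⟨n - 1, by omega⟩ : Fin n) D) '' stdMon J i,
        DrlLT s b := by
  have hδ' : δ = ∑ j, (d j - 1) := by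
    rw [hδ, Finset.sum_tsub_distrib _ fun j _ => hd j]
    simp
  set l : Fin n := ⟨n - 1, by omega⟩ with hl
  have hlmax : ∀ j : Fin n, j ≤ l := fun j => Fin.le_def.2 (by simp [hl]; omega)
  have himage : (fun ν => ν + Finsupp.single l D) '' stdMon J i ⊆ stdMon J (D + i) := by
    rintro _ ⟨μ, hμ, rfl⟩
    subst hJ
    exact add_single_mem_stdMon (fun p hp t => homogeneousComponent_mem_span_range hf.1 hp t) hlmax
      (fun u hu h => mem_span_of_X_pow_mul_mem_of_isGenericSeq hd hf l
        (by simp only [hl]; omega) i D (by omega) u hu h) hμ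
  have hcard : ((fun ν => ν + Finsupp.single l D) '' stdMon J i).ncard = (stdMon J i).ncard :=
    Set.ncard_image_of_injective _ (add_left_injective _)
  refine ⟨hcard ▸ Set.ncard_le_ncard himage (finite_stdMon J _), himage, hcard, ?_⟩
  rintro s hs b ⟨hb, hbs⟩
  refine Or.inr ⟨(himage hs).1.trans hb.1.symm, l, ?_, fun j hj => absurd hj (hlmax j).not_gt⟩
  obtain ⟨μ, hμ, rfl⟩ := hs
  have hbD : b l < D := by
    by_contra! hDb
    have hle : b - Finsupp.single l D + Finsupp.single l D = b :=
      tsub_add_cancel_of_le (Finsupp.single_le_iff.2 hDb)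
    refine hbs ⟨b - Finsupp.single l D, ?_, hle⟩
    have hdeg := congrArg Finsupp.degree hle
    rw [map_add, Finsupp.degree_single, ← expDeg_eq_degree b, hb.1] at hdeg
    have h := mem_stdMon_of_add_mem (hle.symm ▸ hb)
    rwa [show (b - Finsupp.single l D).degree = i by omega] at h
  simp
  omega
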